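/- Let n, m ≥ 0 be integers with 2n+m ≥ 2, and let G be a finite simple graph with χ_{n,m}(G) = k where k ≥ 4. Then the acyclic chromatic number of G satisfies χ_a(G) ≤ k^2 + k^{2 + ⌈log_{2n+m} log_{2n+m} k⌉}. -/

import Mathlib

open SimpleGraph

/-- The involution pairing the label of an arc with the label of the corresponding
reverse arc: for `1 ≤ k ≤ 2n`, the labels `2i` (arc of type `i`) and `2i-1`
(reverse arc of type `i`) are swapped; edge labels `2n+1, …, 2n+m` are fixed. -/
def conjLab (n k : ℕ) : ℕ :=
  if k ≤ 2 * n then (if k % 2 = 0 then k - 1 else k + 1) else k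

/-- An `(n,m)`-graph: a simple underlying graph together with a labelling of each
ordered pair of adjacent vertices by a number in `{1, …, 2n+m}` (`lab u v = α`
means that `v` is an `α`-neighbor of `u`), compatible with reversal. -/
structure NMGraph (n m : ℕ) (V : Type) where
  und : SimpleGraph V
  lab : V → V → ℕ
  lab_mem : ∀ u v, und.Adj u v → 1 ≤ lab u v ∧ lab u v ≤ 2 * n + m
  lab_conj : ∀ u v, und.Adj u v → lab v u = conjLab n (lab u v)

/-- `N^α(u)`, the set of `α`-neighbors of `u`. -/
def NMGraph.nbr {n m : ℕ} {V : Type} (G : NMGraph n m V) (α : ℕ) (u : V) : Set V :=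
  {v | G.und.Adj u v ∧ G.lab u v = α}

/-- `G → H`: existence of a homomorphism of `(n,m)`-graphs, i.e. a vertex map
preserving adjacency together with the type (and direction) of every arc/edge. -/
def NMGraph.HomTo {n m : ℕ} {V W : Type} (G : NMGraph n m V) (H : NMGraph n m W) : Prop :=
  ∃ f : V → W, ∀ u v, G.und.Adj u v →
    H.und.Adj (f u) (f v) ∧ H.lab (f u) (f v) = G.lab u v

/-- The `(n,m)`-chromatic number of an `(n,m)`-graph: the least number of vertices
of a target of a homomorphism. -/
noncomputable def nmChrom (n m : ℕ) {V : Type} (G : NMGraph n m V) : ℕ :=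
  sInf {t | ∃ H : NMGraph n m (Fin t), G.HomTo H}

/-- The acyclic chromatic number: the least `s` admitting a proper `s`-coloring in
which the union of any two color classes induces a forest. -/
noncomputable def acyclicChromatic {V : Type} (G : SimpleGraph V) : ℕ :=
  sInf {s | ∃ c : V → Fin s, (∀ u v, G.Adj u v → c u ≠ c v) ∧
    ∀ i j : Fin s, (SimpleGraph.induce {v : V | c v = i ∨ c v = j} G).IsAcyclic}

/-- The `(n,m)`-chromatic number of a simple graph: the maximum of `nmChrom` over
all `(n,m)`-graphs with that underlying graph. -/
noncomputable def nmChromGraph (n m : ℕ) {V : Type} (S : SimpleGraph V) : ℕ :=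
  sSup {k | ∃ G : NMGraph n m V, G.und = S ∧ nmChrom n m G = k}

theorem conjLab_mem {n m a : ℕ} (h : 1 ≤ a ∧ a ≤ 2 * n + m) :
    1 ≤ conjLab n a ∧ conjLab n a ≤ 2 * n + m := by
  unfold conjLab
  split_ifs <;> omega

theorem conjLab_conjLab {n a : ℕ} (h : 1 ≤ a) : conjLab n (conjLab n a) = a := by
  unfold conjLab
  split_ifs <;> omega

/-- The `(n,m)`-graph on `S` whose labels, read along increasing `r`, are prescribed by `l`
(shifted by one). -/
noncomputable def NMGraph.ofLabels {n m : ℕ} {V : Type} (S : SimpleGraph V) (r : V → ℕ)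
    (hr : r.Injective) (l : V → V → Fin (2 * n + m)) : NMGraph n m V where
  und := S
  lab u v := if r u < r v then l u v + 1 else conjLab n (l v u + 1)
  lab_mem u v _ := by
    have h₁ := (l u v).isLt
    have h₂ := (l v u).isLt
    split_ifs
    · omega
    · exact conjLab_mem ⟨by omega, by omega⟩
  lab_conj u v huv := by
    have hne : r u ≠ r v := fun h => huv.ne (hr h)
    rcases hne.lt_or_gt with h | h
    · rw [if_pos h, if_neg h.not_gt]
    · rw [if_pos h, if_neg h.not_gt, conjLab_conjLab (by omega)]

theorem NMGraph.exists_homTo_fin_card {n m : ℕ} {V : Type} [Fintype V] (G : NMGraph n m V) :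
    ∃ H : NMGraph n m (Fin (Fintype.card V)), G.HomTo H := by
  let e := Fintype.equivFin V
  refine ⟨⟨G.und.comap e.symm, fun i j => G.lab (e.symm i) (e.symm j),
    fun i j h => G.lab_mem _ _ h, fun i j h => G.lab_conj _ _ h⟩, e, fun u v h => ?_⟩
  simpa using h

theorem nmChrom_le_nmChromGraph {n m : ℕ} {V : Type} [Fintype V] (G : NMGraph n m V) :
    nmChrom n m G ≤ nmChromGraph n m G.und := by
  refine le_csSup ⟨Fintype.card V, ?_⟩ ⟨G, rfl, rfl⟩
  rintro _ ⟨G', -, rfl⟩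
  exact Nat.sInf_le G'.exists_homTo_fin_card

/-- Every labelling of the edges of `S` by `p` labels is, along increasing `r`, determined by the
colors of the endpoints in some proper `k`-coloring. -/
def LabelColorable {V : Type} (S : SimpleGraph V) (r : V → ℕ) (p k : ℕ) : Prop :=
  ∀ l : V → V → Fin p, ∃ (f : V → Fin k) (h : Fin k → Fin k → Fin p),
    ∀ u v, S.Adj u v → r u < r v → f u ≠ f v ∧ h (f u) (f v) = l u v

theorem labelColorable_nmChromGraph {n m : ℕ} (hp : 0 < 2 * n + m) {V : Type} [Fintype V]
    (S : SimpleGraph V) (r : V → ℕ) (hr : r.Injective) :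
    LabelColorable S r (2 * n + m) (nmChromGraph n m S) := by
  intro l
  have hle := nmChrom_le_nmChromGraph (NMGraph.ofLabels S r hr l)
  obtain ⟨H, f, hf⟩ : nmChrom n m (NMGraph.ofLabels S r hr l) ∈
      {t | ∃ H : NMGraph n m (Fin t), (NMGraph.ofLabels S r hr l).HomTo H} :=
    Nat.sInf_mem ⟨_, (NMGraph.ofLabels S r hr l).exists_homTo_fin_card⟩
  refine ⟨fun v => Fin.castLE hle (f v), fun i j =>
    if h : (i : ℕ) < nmChrom n m (NMGraph.ofLabels S r hr l) ∧
        (j : ℕ) < nmChrom n m (NMGraph.ofLabels S r hr l)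
      then ⟨(H.lab ⟨i, h.1⟩ ⟨j, h.2⟩ - 1) % (2 * n + m), Nat.mod_lt _ hp⟩
      else ⟨0, hp⟩, fun u v huv hlt => ?_⟩
  obtain ⟨hadj, hlab⟩ := hf u v huv
  refine ⟨fun h => hadj.ne (Fin.castLE_injective hle h), ?_⟩
  have hlab' : H.lab (f u) (f v) = l u v + 1 := hlab.trans (if_pos hlt)
  refine (dif_pos ⟨(f u).isLt, (f v).isLt⟩).trans (Fin.ext ?_)
  change (H.lab (f u) (f v) - 1) % (2 * n + m) = l u v
  rw [hlab', Nat.add_sub_cancel, Nat.mod_eq_of_lt (l u v).isLt]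

theorem SimpleGraph.isAcyclic_of_subsingleton_upper {α : Type*} {G : SimpleGraph α} (r : α → ℕ)
    (hr : r.Injective)
    (h : ∀ v w w', G.Adj v w → G.Adj v w' → r v < r w → r v < r w' → w = w') :
    G.IsAcyclic := by
  classical
  intro v₀ c hc
  obtain ⟨v, hv, hmin⟩ := c.support.toFinset.exists_min_image r ⟨v₀, by simp⟩
  rw [List.mem_toFinset] at hv
  obtain ⟨w, w', hne, hw⟩ := Set.ncard_eq_two.1 (hc.ncard_neighborSet_toSubgraph_eq_two hv)
  have upper : ∀ x ∈ c.toSubgraph.neighborSet v, G.Adj v x ∧ r v < r x := by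
    intro x hx
    have hx' : c.toSubgraph.Adj v x := hx
    refine ⟨hx'.adj_sub, lt_of_le_of_ne (hmin x ?_) fun e => hx'.adj_sub.ne (hr e)⟩
    rw [List.mem_toFinset, ← Walk.mem_verts_toSubgraph]
    exact c.toSubgraph.edge_vert hx'.symm
  have h₁ := upper w (by rw [hw]; simp)
  have h₂ := upper w' (by rw [hw]; simp)
  exact hne (h v w w' h₁.1 h₂.1 h₁.2 h₂.2)

theorem acyclicChromatic_le_card {V C : Type} [Fintype C] {G : SimpleGraph V} (c : V → C)
    (hc : ∀ u v, G.Adj u v → c u ≠ c v)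
    (hac : ∀ i j, (SimpleGraph.induce {v : V | c v = i ∨ c v = j} G).IsAcyclic) :
    acyclicChromatic G ≤ Fintype.card C := by
  let e := Fintype.equivFin C
  refine Nat.sInf_le ⟨e ∘ c, fun u v h h' => hc u v h (e.injective h'), fun i j => ?_⟩
  have hset : {v | (e ∘ c) v = i ∨ (e ∘ c) v = j} = {v | c v = e.symm i ∨ c v = e.symm j} := by
    ext v
    simp [e.eq_symm_apply]
  rw [hset]
  exact hac _ _

open Classical in
theorem LabelColorable.pow_card_edges_le {V : Type} {S : SimpleGraph V} {r : V → ℕ} {p k : ℕ}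
    (hp : 0 < p) (hS : LabelColorable S r p k) (W : Finset V) :
    p ^ ((W ×ˢ W).filter fun x => S.Adj x.1 x.2 ∧ r x.1 < r x.2).card ≤
      k ^ W.card * p ^ (k * k) := by
  set E := (W ×ˢ W).filter fun x => S.Adj x.1 x.2 ∧ r x.1 < r x.2
  have key : ∀ a : E → Fin p, ∃ φ : (W → Fin k) × (Fin k × Fin k → Fin p),
      ∀ (x : E) (h₁ : x.1.1 ∈ W) (h₂ : x.1.2 ∈ W),
        φ.2 (φ.1 ⟨_, h₁⟩, φ.1 ⟨_, h₂⟩) = a x := by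
    intro a
    obtain ⟨f, h, hfh⟩ := hS fun u v => if hx : (u, v) ∈ E then a ⟨_, hx⟩ else ⟨0, hp⟩
    refine ⟨⟨fun w => f w, fun q => h q.1 q.2⟩, fun x h₁ h₂ => ?_⟩
    have hx := (Finset.mem_filter.1 x.2).2
    exact (hfh _ _ hx.1 hx.2).2.trans (dif_pos x.2)
  choose φ hφ using key
  have hinj : φ.Injective := by
    intro a b hab
    ext x : 1
    have hx := Finset.mem_product.1 (Finset.mem_filter.1 x.2).1
    rw [← hφ a x hx.1 hx.2, hab, hφ b x hx.1 hx.2]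
  simpa using Fintype.card_le_of_injective φ hinj

open Classical in
theorem sum_degree_eq_two_mul {V : Type} (S : SimpleGraph V) {r : V → ℕ} (hr : r.Injective)
    (W : Finset V) :
    ∑ v ∈ W, (W.filter (S.Adj v)).card =
      2 * ((W ×ˢ W).filter fun x => S.Adj x.1 x.2 ∧ r x.1 < r x.2).card := by
  have hlt : ∑ v ∈ W, (W.filter fun w => S.Adj v w ∧ r v < r w).card =
      ((W ×ˢ W).filter fun x => S.Adj x.1 x.2 ∧ r x.1 < r x.2).card := by
    simp only [Finset.card_filter, Finset.sum_product]
  have hgt : ∑ v ∈ W, (W.filter fun w => S.Adj v w ∧ r w < r v).card =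
      ((W ×ˢ W).filter fun x => S.Adj x.1 x.2 ∧ r x.1 < r x.2).card := by
    simp only [Finset.card_filter, Finset.sum_product_right, S.adj_comm]
  rw [two_mul, ← hlt]
  nth_rewrite 2 [hlt]
  rw [← hgt, ← Finset.sum_add_distrib]
  refine Finset.sum_congr rfl fun v _ => ?_
  rw [← Finset.card_union_of_disjoint]
  · congr 1
    ext w
    simp only [Finset.mem_filter, Finset.mem_union]
    have : S.Adj v w → r v < r w ∨ r w < r v := fun h => lt_or_gt_of_ne fun e => h.ne (hr e)
    tauto
  · rw [Finset.disjoint_filter]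
    intro w _ h₁ h₂
    omega

open Classical in
theorem LabelColorable.exists_degree_le {V : Type} {S : SimpleGraph V} {r : V → ℕ}
    (hr : r.Injective) {p k P : ℕ} (hp : 2 ≤ p) (hS : LabelColorable S r p k) (hk : k ≤ p ^ P)
    (W : Finset V) (hW : k ^ 2 < W.card) :
    ∃ v ∈ W, (W.filter (S.Adj v)).card ≤ 2 * P + 1 := by
  by_contra! hcon
  have hsum : W.card * (2 * P + 2) ≤ ∑ v ∈ W, (W.filter (S.Adj v)).card := by
    rw [← smul_eq_mul]
    exact Finset.card_nsmul_le_sum _ _ _ fun v hv => hcon v hv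
  rw [sum_degree_eq_two_mul S hr] at hsum
  have hpow := (hS.pow_card_edges_le (by omega) W).trans
    (Nat.mul_le_mul_right _ (Nat.pow_le_pow_left hk W.card))
  rw [← pow_mul, ← pow_add] at hpow
  have := (Nat.pow_le_pow_iff_right (by omega : 1 < p)).1 hpow
  nlinarith

open Classical in
/-- If all vertex sets with more than `K` elements span a vertex of degree at most `D`, then
the vertices can be ordered so that all but the last `K` have at most `D` later neighbors. -/
theorem exists_degenerate_order {V : Type} (S : SimpleGraph V) {K D : ℕ} (r₀ : V → ℕ)
    (hr₀ : r₀.Injective)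
    (h : ∀ W : Finset V, K < W.card → ∃ v ∈ W, (W.filter (S.Adj v)).card ≤ D) (W : Finset V) :
    ∃ (A : Finset V) (r : V → ℕ), A ⊆ W ∧ A.card ≤ K ∧ r.Injective ∧
      (∀ v ∈ W \ A, ∀ w ∈ A, r v < r w) ∧
      ∀ v ∈ W \ A, (W.filter fun w => S.Adj v w ∧ r v < r w).card ≤ D := by
  induction W using Finset.strongInduction with
  | H W ih =>
    rcases le_or_gt W.card K with hK | hK
    · exact ⟨W, r₀, subset_rfl, hK, hr₀, by simp, by simp⟩
    obtain ⟨x, hx, hdeg⟩ := h W hK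
    obtain ⟨A, r, hAW, hA, hr, htop, hback⟩ := ih _ (Finset.erase_ssubset hx)
    have hxA : x ∉ A := fun hxA => Finset.notMem_erase x W (hAW hxA)
    refine ⟨A, fun y => if y = x then 0 else r y + 1, hAW.trans (Finset.erase_subset _ _), hA,
      ?_, ?_, ?_⟩
    · intro y z hyz
      by_cases hy : y = x <;> by_cases hz : z = x <;> simp [hy, hz] at hyz ⊢
      exact hr hyz
    · intro v hv w hw
      have hwx : w ≠ x := fun e => hxA (e ▸ hw)
      by_cases hvx : v = x
      · simp [hvx, hwx]
      · simpa [hvx, hwx] using htop v (by simp_all) w hw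
    · intro v hv
      by_cases hvx : v = x
      · subst hvx
        exact (Finset.card_le_card fun w hw => by simp_all).trans hdeg
      · refine (Finset.card_le_card fun w hw => ?_).trans (hback v (by simp_all))
        by_cases hwx : w = x <;> simp_all

open Classical in
theorem exists_label_injOn {V : Type} [Fintype V] (N : V → Finset V) {L p : ℕ} (hp : 0 < p)
    (T : Set V) (hN : ∀ v ∈ T, (N v).card ≤ p ^ L) :
    ∃ g : V → V → Fin L → Fin p, ∀ v ∈ T, Set.InjOn (g v) (N v) := by
  have : ∀ v, ∃ g : V → Fin L → Fin p, v ∈ T → Set.InjOn g (N v) := by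
    intro v
    by_cases hv : v ∈ T
    · obtain ⟨e⟩ := Function.Embedding.nonempty_of_card_le
        (α := N v) (β := Fin L → Fin p) (by simpa using hN v hv)
      refine ⟨fun w => if hw : w ∈ N v then e ⟨w, hw⟩ else fun _ => ⟨0, hp⟩,
        fun _ a ha b hb hab => ?_⟩
      rw [Finset.mem_coe] at ha hb
      simpa [ha, hb] using hab
    · exact ⟨fun _ _ => ⟨0, hp⟩, fun h => absurd h hv⟩
  choose g hg using this
  exact ⟨g, hg⟩

theorem acyclicChromatic_le_of_labelColorable {V : Type} [Fintype V] {S : SimpleGraph V}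
    {p k L P : ℕ} (hp : 2 ≤ p) (hS : ∀ r : V → ℕ, r.Injective → LabelColorable S r p k)
    (hk : k ≤ p ^ P) (hP : 2 * P + 1 ≤ p ^ L) (hL : 0 < L) :
    acyclicChromatic S ≤ k ^ 2 + k ^ L := by
  classical
  let r₀ : V → ℕ := fun v => Fintype.equivFin V v
  have hr₀ : r₀.Injective := Fin.val_injective.comp (Fintype.equivFin V).injective
  obtain ⟨A, r, -, hA, hr, htop, hback⟩ := exists_degenerate_order S r₀ hr₀
    ((hS r₀ hr₀).exists_degree_le hr₀ hp hk) Finset.univ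
  obtain ⟨g, hg⟩ := exists_label_injOn
    (fun v => Finset.univ.filter fun w => S.Adj v w ∧ r v < r w) (by omega) {v | v ∉ A}
    fun v hv => (hback v (by simpa using hv)).trans hP
  choose f h hfh using fun i : Fin L => hS r hr fun u v => g u v i
  let c : V → A ⊕ (Fin L → Fin k) := fun v =>
    if hv : v ∈ A then Sum.inl ⟨v, hv⟩ else Sum.inr fun i => f i v
  have hinl : ∀ {u v}, u ∈ A → c u = c v → u = v := by
    intro u v hu huv
    by_cases hv : v ∈ A <;> simp_all [c]
  have hinr : ∀ {u v}, u ∉ A → c u = c v → ∀ i, f i u = f i v := by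
    intro u v hu huv
    by_cases hv : v ∈ A <;> simp [c, hu, hv] at huv
    exact congrFun huv
  have hproper : ∀ u v, S.Adj u v → c u ≠ c v := by
    intro u v huv hcuv
    by_cases hu : u ∈ A
    · exact huv.ne (hinl hu hcuv)
    have hi := hinr hu hcuv ⟨0, hL⟩
    rcases lt_or_gt_of_ne fun e => huv.ne (hr e) with hlt | hlt
    · exact (hfh _ u v huv hlt).1 hi
    · exact (hfh _ v u huv.symm hlt).1 hi.symm
  refine (acyclicChromatic_le_card c hproper fun i j => ?_).trans (by simpa using hA)
  refine SimpleGraph.isAcyclic_of_subsingleton_upper (fun v => r v.1)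
    (hr.comp Subtype.val_injective) ?_
  rintro ⟨v, hv⟩ ⟨w, hw⟩ ⟨w', hw'⟩ hvw hvw' hlt hlt'
  replace hvw : S.Adj v w := hvw
  replace hvw' : S.Adj v w' := hvw'
  have hcw : c w = c w' := by
    have h₁ := hproper _ _ hvw
    have h₂ := hproper _ _ hvw'
    simp only [Set.mem_ofPred_eq] at hv hw hw'
    grind
  rw [Subtype.mk.injEq]
  by_cases hwA : w ∈ A
  · exact hinl hwA hcw
  have hvA : v ∉ A := fun hvA => (htop w (by simpa using hwA) v hvA).not_gt hlt
  refine hg v hvA (by simpa using ⟨hvw, hlt⟩) (by simpa using ⟨hvw', hlt'⟩) (funext fun i => ?_)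
  rw [← (hfh i v w hvw hlt).2, ← (hfh i v w' hvw' hlt').2, hinr hwA hcw]

theorem neg_one_lt_logb_logb {p k : ℕ} (hp : 2 ≤ p) (hk : 2 ≤ k) :
    -1 < Real.logb p (Real.logb p k) := by
  have hp' : (1 : ℝ) < p := by exact_mod_cast hp
  have hk' : (0 : ℝ) < k := by positivity
  have hpk : (p : ℝ) < (k : ℝ) ^ p := by
    exact_mod_cast p.lt_two_pow_self.trans_le (Nat.pow_le_pow_left hk p)
  have h₁ : 1 < p * Real.logb p k := by
    rw [← Real.logb_pow, ← Real.logb_self_eq_one hp']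
    exact Real.logb_lt_logb hp' (by linarith) hpk
  have h₂ : (p : ℝ) ^ (-1 : ℝ) < Real.logb p k := by
    rw [Real.rpow_neg_one, inv_lt_iff_one_lt_mul₀ (by linarith)]
    linarith
  exact (Real.lt_logb_iff_rpow_lt hp' ((Real.rpow_pos_of_pos (by linarith) _).trans h₂)).2 h₂

theorem le_pow_pow_of_logb_logb_le {p k e : ℕ} (hp : 2 ≤ p) (hk : 2 ≤ k)
    (h : Real.logb p (Real.logb p k) ≤ e) : k ≤ p ^ p ^ e := by
  have hp' : (1 : ℝ) < p := by exact_mod_cast hp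
  have hk' : (1 : ℝ) < k := by exact_mod_cast hk
  rw [Real.logb_le_iff_le_rpow hp' (Real.logb_pos hp' hk'),
    Real.logb_le_iff_le_rpow hp' (by linarith), Real.rpow_natCast] at h
  exact_mod_cast h

/-- If `χ_{n,m}(G) = k ≥ 4`, then
`χ_a(G) ≤ k² + k ^ (2 + ⌈log_{2n+m} log_{2n+m} k⌉)`. -/
theorem acyclicChromatic_le_of_nmChrom (n m : ℕ) (hp : 2 ≤ 2 * n + m)
    {V : Type} [Fintype V] (S : SimpleGraph V) (k : ℕ) (hk4 : 4 ≤ k)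
    (hk : nmChromGraph n m S = k) :
    (acyclicChromatic S : ℝ) ≤
      (k : ℝ) ^ 2 +
        (k : ℝ) ^ ((2 : ℤ) + ⌈Real.logb (2 * n + m) (Real.logb (2 * n + m) k)⌉) := by
  have hpos : -1 < Real.logb (2 * n + m) (Real.logb (2 * n + m) k) := by
    simpa using neg_one_lt_logb_logb hp (by omega : 2 ≤ k)
  have hceil : 0 ≤ ⌈Real.logb (2 * n + m) (Real.logb (2 * n + m) k)⌉ := by
    rw [← Int.sub_one_lt_iff, Int.lt_ceil]
    simpa using hpos
  obtain ⟨e, he⟩ := Int.eq_ofNat_of_zero_le hceil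
  have hle : k ≤ (2 * n + m) ^ (2 * n + m) ^ e :=
    le_pow_pow_of_logb_logb_le hp (by omega) (by
      simpa using Int.ceil_le.1 he.le)
  have hP : 2 * (2 * n + m) ^ e + 1 ≤ (2 * n + m) ^ (2 + e) := by
    have h₁ : 1 ≤ (2 * n + m) ^ e := Nat.one_le_pow _ _ (by omega)
    have h₂ : 2 ^ 2 ≤ (2 * n + m) ^ 2 := Nat.pow_le_pow_left hp 2
    rw [pow_add]
    nlinarith
  have hmain := acyclicChromatic_le_of_labelColorable hp
    (fun r hr => hk ▸ labelColorable_nmChromGraph (by omega) S r hr) hle hP (by omega)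
  rw [he]
  exact_mod_cast hmain
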